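/- arXiv:2009.03099 — 2 statements merged into one kernel-verified Lean document; each statement's English description precedes it below -/
import Mathlib

section
/- Let h : ℝ² → ℝ be a positively homogeneous function, let E* be a finite upper exhauster of h, and let C₀ ∈ E*. If ρ_{C₀}(θ) > ρ(θ) for all θ ∈ [0, 2π], where ρ(θ) = min_{C ∈ E*} ρ_C(θ), then the family E* \ {C₀} is again an upper exhauster of h. -/
open Set Real
open scoped RealInnerProductSpace

noncomputable def suppFn (C : Set (EuclideanSpace ℝ (Fin 2))) (g : EuclideanSpace ℝ (Fin 2)) : ℝ :=
  sSup ((fun v => ⟪v, g⟫) '' C)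

def IsUpperExhauster (h : EuclideanSpace ℝ (Fin 2) → ℝ)
    (E : Set (Set (EuclideanSpace ℝ (Fin 2)))) : Prop :=
  (∀ C ∈ E, C.Nonempty ∧ IsCompact C ∧ Convex ℝ C) ∧
  ∀ g, IsGLB ((fun C => suppFn C g) '' E) (h g)

noncomputable def udir (θ : ℝ) : EuclideanSpace ℝ (Fin 2) :=
  (EuclideanSpace.equiv (Fin 2) ℝ).symm ![Real.cos θ, Real.sin θ]

noncomputable def rho (C : Set (EuclideanSpace ℝ (Fin 2))) (θ : ℝ) : ℝ := suppFn C (udir θ)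

theorem suppFn_smul (C : Set (EuclideanSpace ℝ (Fin 2))) {r : ℝ} (hr : 0 ≤ r)
    (g : EuclideanSpace ℝ (Fin 2)) : suppFn C (r • g) = r * suppFn C g := by
  unfold suppFn
  rw [← smul_eq_mul, ← Real.sSup_smul_of_nonneg hr, ← Set.image_smul, Set.image_image]
  simp only [inner_smul_right, smul_eq_mul]

theorem exists_eq_smul_udir (g : EuclideanSpace ℝ (Fin 2)) :
    ∃ r : ℝ, 0 ≤ r ∧ ∃ θ ∈ Icc (0 : ℝ) (2 * π), g = r • udir θ := by
  have hcos := Complex.norm_mul_cos_arg ⟨g 0, g 1⟩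
  have hsin := Complex.norm_mul_sin_arg ⟨g 0, g 1⟩
  have hlt := Complex.neg_pi_lt_arg ⟨g 0, g 1⟩
  have hle := Complex.arg_le_pi ⟨g 0, g 1⟩
  refine ⟨_, norm_nonneg (⟨g 0, g 1⟩ : ℂ), ?_⟩
  rcases le_total 0 (Complex.arg ⟨g 0, g 1⟩) with h0 | h0
  · refine ⟨_, ⟨h0, by linarith⟩, ?_⟩
    ext i
    fin_cases i <;> simp [udir, hcos, hsin]
  · refine ⟨Complex.arg ⟨g 0, g 1⟩ + 2 * π, ⟨by linarith, by linarith⟩, ?_⟩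
    ext i
    fin_cases i <;> simp [udir, hcos, hsin]

theorem discard_of_strictly_above_min
    (h : EuclideanSpace ℝ (Fin 2) → ℝ)
    (hph : ∀ (l : ℝ) (g : EuclideanSpace ℝ (Fin 2)), 0 ≤ l → h (l • g) = l * h g)
    (E : Set (Set (EuclideanSpace ℝ (Fin 2)))) (hfin : E.Finite)
    (C₀ : Set (EuclideanSpace ℝ (Fin 2)))
    (hE : IsUpperExhauster h E) (hC₀ : C₀ ∈ E)
    (hyp : ∀ θ ∈ Icc (0:ℝ) (2 * π), sInf ((fun C => rho C θ) '' E) < rho C₀ θ) :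
    IsUpperExhauster h (E \ {C₀}) := by
  refine ⟨fun C hC => hE.1 C hC.1, fun g => ?_⟩
  obtain ⟨r, hr, θ, hθ, rfl⟩ := exists_eq_smul_udir g
  have himg : ((fun C => rho C θ) '' E).Finite := hfin.image _
  obtain ⟨C, hC, hCmin⟩ := (Set.Nonempty.image (fun C => rho C θ) ⟨C₀, hC₀⟩).csInf_mem himg
  have hlt := hyp θ hθ
  rw [← hCmin] at hlt
  have hne : C ≠ C₀ := by
    rintro rfl
    exact lt_irrefl _ hlt
  have hmin : ∀ D ∈ E, rho C θ ≤ rho D θ := fun D hD =>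
    hCmin.trans_le (csInf_le himg.bddBelow (mem_image_of_mem _ hD))
  have hglb := hE.2 (r • udir θ)
  refine ⟨lowerBounds_mono_set (image_mono sdiff_subset) hglb.1, fun b hb => hglb.2 ?_⟩
  rintro _ ⟨D, hD, rfl⟩
  refine (hb (mem_image_of_mem _ ⟨hC, hne⟩)).trans ?_
  simp only [suppFn_smul _ hr]
  exact mul_le_mul_of_nonneg_left (hmin D hD) hr
end

section
/- Let h : ℝ² → ℝ be a positively homogeneous function and let E* be a finite upper exhauster of h with at least two elements. Then E* is minimal by inclusion if and only if for every C₀ ∈ E* there exists some θ ∈ [0, 2π] such that ρ_{C₀}(θ) < ρ_C(θ) for every C ∈ E* \ {C₀} (i.e., each set of the exhauster is, at some direction, the unique set attaining the pointwise minimum of the support-function values). -/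
open Set Real
open scoped RealInnerProductSpace

theorem IsUpperExhauster.exists_eq_suppFn {h : EuclideanSpace ℝ (Fin 2) → ℝ}
    {E : Set (Set (EuclideanSpace ℝ (Fin 2)))} (hE : IsUpperExhauster h E) (hfin : E.Finite)
    (g : EuclideanSpace ℝ (Fin 2)) : ∃ C ∈ E, suppFn C g = h g := by
  have hglb := hE.2 g
  have hmem : h g ∈ (fun C => suppFn C g) '' E := by
    rw [← hglb.csInf_eq hglb.nonempty]
    exact hglb.nonempty.csInf_mem (hfin.image _)
  exact hmem

theorem minimal_iff_unique_min_direction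
    (h : EuclideanSpace ℝ (Fin 2) → ℝ)
    (hph : ∀ (l : ℝ) (g : EuclideanSpace ℝ (Fin 2)), 0 ≤ l → h (l • g) = l * h g)
    (E : Set (Set (EuclideanSpace ℝ (Fin 2)))) (hfin : E.Finite)
    (hE : IsUpperExhauster h E) (hcard : E.Nontrivial) :
    (¬ ∃ E' ⊂ E, IsUpperExhauster h E') ↔
      ∀ C₀ ∈ E, ∃ θ ∈ Icc (0:ℝ) (2 * π), ∀ C ∈ E \ {C₀}, rho C₀ θ < rho C θ := by
  constructor
  · intro hmin
    by_contra! hcon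
    obtain ⟨C₀, hC₀, hdom⟩ := hcon
    refine hmin ⟨E \ {C₀}, sdiff_singleton_ssubset.2 hC₀, fun C hC => hE.1 C hC.1, fun g => ?_⟩
    obtain ⟨r, hr, θ, hθ, rfl⟩ := exists_eq_smul_udir g
    obtain ⟨C₁, hC₁, hle⟩ := hdom θ hθ
    refine ⟨fun x hx => (hE.2 _).1 (image_mono sdiff_subset hx), fun b hb => (hE.2 _).2 ?_⟩
    rintro _ ⟨C, hC, rfl⟩
    by_cases hCC : C = C₀
    · subst hCC
      refine (hb (mem_image_of_mem _ hC₁)).trans ?_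
      simp only [suppFn_smul _ hr]
      exact mul_le_mul_of_nonneg_left hle hr
    · exact hb (mem_image_of_mem _ ⟨hC, hCC⟩)
  · rintro hdir ⟨E', hss, hE'⟩
    obtain ⟨C₀, hC₀, hC₀'⟩ := exists_of_ssubset hss
    obtain ⟨θ, -, hlt⟩ := hdir C₀ hC₀
    obtain ⟨C₁, hC₁, heq⟩ := hE'.exists_eq_suppFn (hfin.subset hss.subset) (udir θ)
    have hC₁₀ : C₁ ≠ C₀ := fun h => hC₀' (h ▸ hC₁)
    have hle : h (udir θ) ≤ rho C₀ θ := (hE.2 _).1 (mem_image_of_mem _ hC₀)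
    exact (hlt C₁ ⟨hss.subset hC₁, hC₁₀⟩).not_ge (heq.trans_le hle)
end
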